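/- Let F(s) := Σ_{n=2}^∞ n^{−2s} / log n, holomorphic on {Re s > 1/2}. There exists an entire function g : ℂ → ℂ such that F(s) = −Log(2s − 1) + g(s) for every s with Re s > 1/2, where Log is the principal branch of the complex logarithm. -/

import Mathlib

noncomputable section

/-- The term `n^{−2s}/log n` (for `n ≥ 2`, indexed by `n - 2`), where
`n^{−2s} := exp(−2s · log n)` with the real logarithm. -/
def Fterm (s : ℂ) (n : ℕ) : ℂ :=
  Complex.exp (-2 * s * (Real.log ((n : ℝ) + 2) : ℂ)) / (Real.log ((n : ℝ) + 2) : ℂ)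

/-- `F(s) = Σ_{n=2}^∞ n^{−2s}/log n`. -/
def Ffun (s : ℂ) : ℂ := ∑' n : ℕ, Fterm s n

end

open Complex Filter Topology LSeries in
/-- `ζ(z) - 1/(z - 1)` extends to an entire function. -/
lemma exists_entire_eq_riemannZeta_sub_inv :
    ∃ h : ℂ → ℂ, Differentiable ℂ h ∧ ∀ z, z ≠ 1 → h z = riemannZeta z - 1 / (z - 1) := by
  let F : ℂ → ℂ := Function.update (fun z ↦ (z - 1) * riemannZeta z) 1 1
  have hF : Differentiable ℂ F := by
    rw [← differentiableOn_univ,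
      ← differentiableOn_compl_singleton_and_continuousAt_iff (c := 1) univ_mem]
    refine ⟨fun z hz ↦ ?_, continuousAt_update_same.mpr riemannZeta_residue_one⟩
    have hz1 : z ≠ 1 := by simpa using hz
    refine DifferentiableAt.differentiableWithinAt ?_
    refine DifferentiableAt.congr_of_eventuallyEq (f := fun z ↦ (z - 1) * riemannZeta z) ?_ ?_
    · exact (differentiableAt_id.sub_const 1).mul (differentiableAt_riemannZeta hz1)
    · filter_upwards [isOpen_ne.mem_nhds hz1] with w hw using Function.update_of_ne hw _ _
  refine ⟨dslope F 1, ?_, fun z hz ↦ ?_⟩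
  · rw [← differentiableOn_univ, differentiableOn_dslope univ_mem]
    exact hF.differentiableOn
  · have hz' : z - 1 ≠ 0 := sub_ne_zero.mpr hz
    rw [dslope_of_ne _ hz, slope_def_field]
    simp only [F, Function.update_self, Function.update_of_ne hz]
    field_simp

/-- The coefficients `1 / log n`, which vanish for `n = 0` and `n = 1`. -/
noncomputable def invLogCoeff (n : ℕ) : ℂ := ((Real.log n)⁻¹ : ℝ)

open Complex LSeries in
lemma abscissaOfAbsConv_invLogCoeff_le : abscissaOfAbsConv invLogCoeff ≤ 1 := by
  refine abscissaOfAbsConv_le_of_le_const ⟨(Real.log 2)⁻¹, fun n hn ↦ ?_⟩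
  rw [invLogCoeff, norm_real, Real.norm_of_nonneg (inv_nonneg.mpr (Real.log_natCast_nonneg n))]
  rcases eq_or_ne n 1 with rfl | h1
  · simpa using Real.log_nonneg one_le_two
  · have h2 : (2 : ℝ) ≤ n := by exact_mod_cast (by omega : 2 ≤ n)
    have := Real.log_pos one_lt_two
    gcongr

open Complex LSeries in
lemma LSeries_logMul_invLogCoeff {s : ℂ} (hs : 1 < s.re) :
    LSeries (logMul invLogCoeff) s = riemannZeta s - 1 := by
  have h : LSeries (logMul invLogCoeff) s = LSeries (1 - delta) s := by
    refine LSeries_congr (fun {n} hn ↦ ?_) s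
    rcases eq_or_ne n 1 with rfl | h1
    · simp [logMul, delta]
    · have h2 : (1 : ℝ) < n := by exact_mod_cast (by omega : 1 < n)
      have h3 : (Real.log n : ℂ) ≠ 0 := by exact_mod_cast (Real.log_pos h2).ne'
      simp only [logMul, invLogCoeff, delta, h1, Pi.sub_apply, Pi.one_apply, if_false, sub_zero,
        ofReal_inv, ← natCast_log]
      exact mul_inv_cancel₀ h3
  have hδ : LSeriesSummable delta s :=
    LSeriesSummable_of_bounded_of_one_lt_re (m := 1)
      (fun n _ ↦ by by_cases h : n = 1 <;> simp [delta, h]) hs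
  rw [h, LSeries_sub (LSeriesSummable_one_iff.mpr hs) hδ, LSeries_one_eq_riemannZeta hs,
    LSeries_delta, Pi.one_apply]

open Complex LSeries in
lemma Ffun_eq_LSeries {s : ℂ} (hs : 1 / 2 < s.re) : Ffun s = LSeries invLogCoeff (2 * s) := by
  have hre : 1 < (2 * s).re := by simp; linarith
  have hsum : LSeriesSummable invLogCoeff (2 * s) :=
    LSeriesSummable_of_abscissaOfAbsConv_lt_re
      (abscissaOfAbsConv_invLogCoeff_le.trans_lt (by exact_mod_cast hre))
  rw [LSeries, ← Summable.sum_add_tsum_nat_add 2 hsum, Ffun]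
  simp only [Finset.sum_range_succ, Finset.sum_range_zero, term_zero, zero_add]
  have h1 : term invLogCoeff (2 * s) 1 = 0 := by simp [term, invLogCoeff]
  rw [h1, zero_add]
  refine tsum_congr fun n ↦ ?_
  rw [term_of_ne_zero (by omega), Fterm, cpow_def_of_ne_zero (Nat.cast_ne_zero.mpr (by omega)),
    invLogCoeff, ← natCast_log]
  push_cast
  rw [show (-2 * s * (Real.log ((n : ℝ) + 2) : ℂ)) = -((Real.log ((n : ℝ) + 2) : ℂ) * (2 * s)) by
    ring, Complex.exp_neg]
  ring

/-- There exists an entire function `g : ℂ → ℂ` such that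
`F(s) = −Log(2s − 1) + g(s)` for every `s` with `Re s > 1/2`, where `Log` is the
principal branch of the complex logarithm. -/
theorem stmt15 :
    ∃ g : ℂ → ℂ, Differentiable ℂ g ∧
      ∀ s : ℂ, 1 / 2 < s.re → Ffun s = -Complex.log (2 * s - 1) + g s := by
  obtain ⟨h, hh, hζ⟩ := exists_entire_eq_riemannZeta_sub_inv
  obtain ⟨G, hG⟩ := (hh.sub_const 1).isExactOn_univ
  replace hG : ∀ z, HasDerivAt G (h z - 1) z := fun z ↦ hG z (Set.mem_univ z)
  let U : Set ℂ := {z | 1 < z.re}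
  have hU : IsOpen U := isOpen_lt continuous_const Complex.continuous_re
  have hUc : IsPreconnected U := (convex_halfSpace_re_gt 1).isPreconnected
  let Φ : ℂ → ℂ := fun z ↦ LSeries invLogCoeff z + Complex.log (z - 1) + G z
  have hΦ : ∀ z ∈ U, HasDerivAt Φ 0 z := by
    intro z hz
    have hz : 1 < z.re := hz
    have h1 := LSeries_hasDerivAt
      (abscissaOfAbsConv_invLogCoeff_le.trans_lt (by exact_mod_cast hz : (1 : EReal) < z.re))
    have h2 := ((hasDerivAt_id z).sub_const 1).clog
      (Or.inl (by simpa using hz))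
    convert! (h1.add h2).add (hG z) using 1
    rw [LSeries_logMul_invLogCoeff hz, hζ z (by rintro rfl; simp at hz)]
    simp only [id_eq]
    ring
  obtain ⟨c, hc⟩ := hU.exists_is_const_of_deriv_eq_zero hUc
    (fun z hz ↦ (hΦ z hz).differentiableAt.differentiableWithinAt) (fun z hz ↦ (hΦ z hz).deriv)
  have hGd : Differentiable ℂ G := fun z ↦ (hG z).differentiableAt
  refine ⟨fun s ↦ c - G (2 * s), by fun_prop, fun s hs ↦ ?_⟩
  have := hc (2 * s) (by simp [U]; linarith)
  rw [Ffun_eq_LSeries hs, ← this]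
  simp only [Φ]
  ring
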